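/- Let −π/2 < α < π/2 and 0 ≤ β < 1, set c = (1−β) cos α, and let f ∈ SP_α(β). Set ξ = |f″(0)|/(2c) and assume ξ < 1. Then for all z ∈ 𝔻, (1 − |z|²)² |S_f(z)| ≤ 2c (1 + |1 − (1−β) e^{−iα} cos α| · (ξ + |z|)²/(1 − ξ²)), where S_f = (f″/f′)′ − (1/2)(f″/f′)². -/

import Mathlib

open ComplexConjugate in
theorem aux_ident (a w : ℂ) :
    ‖1 - conj a * w‖ ^ 2 - ‖w - a‖ ^ 2 = (1 - ‖a‖ ^ 2) * (1 - ‖w‖ ^ 2) := by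
  simp only [← Complex.normSq_eq_norm_sq, Complex.normSq_apply]
  simp
  ring

open ComplexConjugate in
theorem aux_den {a w : ℂ} (ha : ‖a‖ < 1) (hw : ‖w‖ < 1) : 1 - conj a * w ≠ 0 := by
  intro h
  have h1 : conj a * w = 1 := by linear_combination -h
  have h2 : ‖a‖ * ‖w‖ = 1 := by
    have := congrArg norm h1
    simpa using this
  nlinarith [norm_nonneg a, norm_nonneg w]

open ComplexConjugate in
theorem aux_mob {a w : ℂ} (ha : ‖a‖ < 1) (hw : ‖w‖ < 1) :
    ‖(w - a) / (1 - conj a * w)‖ < 1 := by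
  have hd := aux_den ha hw
  have hp : 0 < ‖1 - conj a * w‖ := norm_pos_iff.mpr hd
  rw [norm_div, div_lt_one hp]
  have h := aux_ident a w
  have h1 : 0 < 1 - ‖a‖ ^ 2 := by nlinarith [norm_nonneg a]
  have h2 : 0 < 1 - ‖w‖ ^ 2 := by nlinarith [norm_nonneg w]
  have := mul_pos h1 h2
  exact lt_of_pow_lt_pow_left₀ 2 hp.le (by linarith)

open ComplexConjugate in
theorem aux_comp {g : ℂ → ℂ} (hg : DifferentiableOn ℂ g (Metric.ball 0 1))
    (hm : ∀ z ∈ Metric.ball (0 : ℂ) 1, ‖g z‖ < 1) :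
    DifferentiableOn ℂ (fun w => (g w - g 0) / (1 - conj (g 0) * g w)) (Metric.ball 0 1) ∧
    Set.MapsTo (fun w => (g w - g 0) / (1 - conj (g 0) * g w)) (Metric.ball 0 1)
      (Metric.closedBall 0 1) := by
  have h0 : ‖g 0‖ < 1 := hm 0 (by simp)
  constructor
  · refine (hg.sub_const _).div ((hg.const_mul _).const_sub _) ?_
    intro w hw
    exact aux_den h0 (hm w hw)
  · intro w hw
    simpa using (aux_mob h0 (hm w hw)).le

open ComplexConjugate in
theorem aux_growth {g : ℂ → ℂ} (hg : DifferentiableOn ℂ g (Metric.ball 0 1))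
    (hm : ∀ z ∈ Metric.ball (0 : ℂ) 1, ‖g z‖ < 1) {z : ℂ} (hz : ‖z‖ < 1) :
    ‖g z‖ * (1 + ‖g 0‖ * ‖z‖) ≤ ‖g 0‖ + ‖z‖ := by
  obtain ⟨h1, h2⟩ := aux_comp hg hm
  have h0 : ‖g 0‖ < 1 := hm 0 (by simp)
  have hgz : ‖g z‖ < 1 := hm z (by simpa using hz)
  have h3 := Complex.norm_le_norm_of_mapsTo_ball h1 h2 (by simp) hz
  have hp : 0 < ‖1 - conj (g 0) * g z‖ := norm_pos_iff.mpr (aux_den h0 hgz)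
  simp only [norm_div] at h3
  rw [div_le_iff₀ hp] at h3
  have hid := aux_ident (g 0) (g z)
  set a := ‖g 0‖
  set t := ‖g z‖
  set r := ‖z‖
  have ha : 0 ≤ a := norm_nonneg _
  have ht : 0 ≤ t := norm_nonneg _
  have hr : 0 ≤ r := norm_nonneg _
  have h4 : 1 - a * t ≤ ‖1 - conj (g 0) * g z‖ := by
    have := norm_sub_norm_le (1 : ℂ) (conj (g 0) * g z)
    simpa [a, t] using this
  have hat : 0 < 1 - a * t := by nlinarith
  have h5 : ‖g z - g 0‖ ^ 2 ≤ r ^ 2 * ‖1 - conj (g 0) * g z‖ ^ 2 := by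
    rw [← mul_pow]
    exact pow_le_pow_left₀ (norm_nonneg _) h3 2
  have h6 : (1 - a * t) ^ 2 ≤ ‖1 - conj (g 0) * g z‖ ^ 2 := pow_le_pow_left₀ hat.le h4 2
  have h7 : 0 ≤ 1 - r ^ 2 := by nlinarith
  have h8 : (1 - r ^ 2) * (1 - a * t) ^ 2 ≤ (1 - a ^ 2) * (1 - t ^ 2) := by
    have := mul_le_mul_of_nonneg_left h6 h7
    nlinarith
  have h9 : (t - a) ^ 2 ≤ (r * (1 - a * t)) ^ 2 := by nlinarith
  have h10 := abs_le_of_sq_le_sq h9 (by positivity)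
  nlinarith [le_abs_self (t - a)]

open ComplexConjugate in
theorem aux_deriv0 {g : ℂ → ℂ} (hg : DifferentiableOn ℂ g (Metric.ball 0 1))
    (hm : ∀ z ∈ Metric.ball (0 : ℂ) 1, ‖g z‖ < 1) :
    ‖deriv g 0‖ ≤ 1 - ‖g 0‖ ^ 2 := by
  obtain ⟨h1, h2⟩ := aux_comp hg hm
  have h0 : ‖g 0‖ < 1 := hm 0 (by simp)
  have h3 := Complex.norm_deriv_le_one_of_mapsTo_ball h1 (by simpa using h2) one_pos
  have hd : HasDerivAt g (deriv g 0) 0 :=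
    (hg.differentiableAt (Metric.ball_mem_nhds 0 one_pos)).hasDerivAt
  have hne := aux_den h0 h0
  have h4 := ((hd.sub_const (g 0)).div ((hd.const_mul (conj (g 0))).const_sub 1) hne)
  have h5 : deriv (fun w => (g w - g 0) / (1 - conj (g 0) * g w)) 0
      = deriv g 0 / (1 - conj (g 0) * g 0) := by
    refine h4.deriv.trans ?_
    field_simp
    ring
  have h6 : ‖1 - conj (g 0) * g 0‖ = 1 - ‖g 0‖ ^ 2 := by
    rw [Complex.conj_mul']
    rw [show (1 : ℂ) - (‖g 0‖ : ℂ) ^ 2 = ((1 - ‖g 0‖ ^ 2 : ℝ) : ℂ) by push_cast; ring]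
    rw [Complex.norm_real, Real.norm_of_nonneg]
    nlinarith [norm_nonneg (g 0)]
  rw [h5, norm_div, h6, div_le_one] at h3
  · exact h3
  · nlinarith [norm_nonneg (g 0)]

open ComplexConjugate in
theorem aux_pick {g : ℂ → ℂ} (hg : DifferentiableOn ℂ g (Metric.ball 0 1))
    (hm : ∀ z ∈ Metric.ball (0 : ℂ) 1, ‖g z‖ < 1) {z : ℂ} (hz : ‖z‖ < 1) :
    ‖deriv g z‖ * (1 - ‖z‖ ^ 2) ≤ 1 - ‖g z‖ ^ 2 := by
  have hz' : ‖-z‖ < 1 := by simpa using hz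
  have hτm : ∀ w ∈ Metric.ball (0 : ℂ) 1,
      (w - -z) / (1 - conj (-z) * w) ∈ Metric.ball (0 : ℂ) 1 := by
    intro w hw
    have := aux_mob hz' (by simpa using hw : ‖w‖ < 1)
    simpa using this
  have hτd : DifferentiableOn ℂ (fun w : ℂ => (w - -z) / (1 - conj (-z) * w))
      (Metric.ball 0 1) := by
    refine (differentiableOn_id.sub_const _).div ((differentiableOn_id.const_mul _).const_sub _) ?_
    intro w hw
    exact aux_den hz' (by simpa using hw)
  have h := aux_deriv0 (g := g ∘ fun w : ℂ => (w - -z) / (1 - conj (-z) * w))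
    (hg.comp hτd hτm) (fun w hw => hm _ (hτm w hw))
  have hτ0 : HasDerivAt (fun w : ℂ => (w - -z) / (1 - conj (-z) * w)) (1 - ‖z‖ ^ 2 : ℂ) 0 := by
    have := ((hasDerivAt_id (0 : ℂ)).sub_const (-z)).div
      (((hasDerivAt_id (0 : ℂ)).const_mul (conj (-z))).const_sub 1) (by simp)
    refine this.congr_deriv ?_
    simp
    rw [Complex.mul_conj']
  have hzb : z ∈ Metric.ball (0 : ℂ) 1 := by simpa using hz
  have hgd : HasDerivAt g (deriv g z) ((0 - -z) / (1 - conj (-z) * 0)) := by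
    simpa using (hg.differentiableAt (Metric.isOpen_ball.mem_nhds hzb)).hasDerivAt
  have h2 := hgd.comp (0 : ℂ) hτ0
  rw [h2.deriv, norm_mul] at h
  rw [show (1 : ℂ) - (‖z‖ : ℂ) ^ 2 = ((1 - ‖z‖ ^ 2 : ℝ) : ℂ) by push_cast; ring,
    Complex.norm_real, Real.norm_of_nonneg (by nlinarith [norm_nonneg z])] at h
  simpa using h

theorem aux_strict {g : ℂ → ℂ} (hg : DifferentiableOn ℂ g (Metric.ball 0 1))
    (hm : ∀ z ∈ Metric.ball (0 : ℂ) 1, ‖g z‖ ≤ 1) (h0 : ‖g 0‖ < 1) :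
    ∀ z ∈ Metric.ball (0 : ℂ) 1, ‖g z‖ < 1 := by
  intro z hz
  refine lt_of_le_of_ne (hm z hz) fun h => ?_
  have hmax : IsMaxOn (norm ∘ g) (Metric.ball 0 1) z := by
    intro w hw
    simpa [h] using hm w hw
  have := Complex.norm_eqOn_of_isPreconnected_of_isMaxOn
    (convex_ball (0 : ℂ) 1).isPreconnected Metric.isOpen_ball hg hz hmax
    (Metric.mem_ball_self one_pos)
  simp at this
  linarith

/-- The purely real inequality at the end. -/
theorem aux_real {r t x d D m : ℝ} (hr : 0 ≤ r) (hr1 : r < 1) (ht : 0 ≤ t) (ht1 : t < 1)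
    (hx : 0 ≤ x) (hx1 : x < 1) (hm : 0 ≤ m)
    (hgr : t * (1 + x * r) ≤ x + r) (hpick : d * (1 - r ^ 2) ≤ 1 - t ^ 2)
    (hD : 1 - r * t ≤ D) :
    (1 - r ^ 2) ^ 2 * ((d + m * t ^ 2) / D ^ 2) ≤ 1 + m * (x + r) ^ 2 / (1 - x ^ 2) := by
  have hrt : 0 < 1 - r * t := by nlinarith
  have hDp : 0 < D := lt_of_lt_of_le hrt hD
  have hr2 : 0 < 1 - r ^ 2 := by nlinarith
  have hD2 : (1 - r * t) ^ 2 ≤ D ^ 2 := pow_le_pow_left₀ hrt.le hD 2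
  have hx2 : 0 < 1 - x ^ 2 := by nlinarith
  have hA : (1 - r ^ 2) ^ 2 * d ≤ D ^ 2 := by
    have := mul_le_mul_of_nonneg_left hpick hr2.le
    nlinarith [sq_nonneg (r - t)]
  have hB : (1 - r ^ 2) * t ≤ (x + r) * (1 - r * t) := by nlinarith
  have hB2 : ((1 - r ^ 2) * t) ^ 2 ≤ (x + r) ^ 2 * D ^ 2 := by
    calc ((1 - r ^ 2) * t) ^ 2 ≤ ((x + r) * (1 - r * t)) ^ 2 :=
          pow_le_pow_left₀ (by positivity) hB 2
      _ = (x + r) ^ 2 * (1 - r * t) ^ 2 := by ring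
      _ ≤ _ := by gcongr
  have hC : m * (x + r) ^ 2 ≤ m * (x + r) ^ 2 / (1 - x ^ 2) := by
    rw [le_div_iff₀ hx2]
    have : 0 ≤ m * (x + r) ^ 2 := by positivity
    nlinarith [sq_nonneg x]
  refine le_trans ?_ (add_le_add_right hC 1)
  rw [← mul_div_assoc, div_le_iff₀ (by positivity)]
  have := mul_le_mul_of_nonneg_left hB2 hm
  nlinarith

/-- For `f ∈ SP_α(β)` (no normalization of `f″(0)`), with
`c = (1−β) cos α` and `ξ = |f″(0)|/(2c) < 1`, one has for all `z ∈ 𝔻`: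
`(1 − |z|²)²|S_f(z)| ≤ 2c (1 + |1 − (1−β)e^{−iα} cos α| (ξ + |z|)²/(1 − ξ²))`,
where `S_f = (f″/f′)′ − ½ (f″/f′)²`. -/
theorem stmt18 (α β : ℝ) (hα₁ : -(Real.pi / 2) < α) (hα₂ : α < Real.pi / 2)
    (hβ₁ : 0 ≤ β) (hβ₂ : β < 1) (c : ℝ) (hc : c = (1 - β) * Real.cos α)
    (f : ℂ → ℂ)
    (hf : DifferentiableOn ℂ f (Metric.ball 0 1))
    (hf0 : f 0 = 0) (hf1 : deriv f 0 = 1)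
    (hf' : ∀ z ∈ Metric.ball (0 : ℂ) 1, deriv f z ≠ 0)
    (hsp : ∀ z ∈ Metric.ball (0 : ℂ) 1,
      β * Real.cos α <
        (Complex.exp (Complex.I * (α : ℂ)) *
          (1 + z * deriv (deriv f) z / deriv f z)).re)
    (ξ : ℝ) (hξ : ξ = ‖deriv (deriv f) 0‖ / (2 * c)) (hξ1 : ξ < 1) :
    ∀ z ∈ Metric.ball (0 : ℂ) 1,
      (1 - ‖z‖ ^ 2) ^ 2 *
          ‖deriv (fun w => deriv (deriv f) w / deriv f w) z -
            (1 / 2 : ℂ) * (deriv (deriv f) z / deriv f z) ^ 2‖ ≤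
        2 * c * (1 +
          ‖(1 : ℂ) - (1 - (β : ℂ)) * Complex.exp (-(Complex.I * (α : ℂ))) *
              (Real.cos α : ℂ)‖ * (ξ + ‖z‖) ^ 2 / (1 - ξ ^ 2)) := by
  intro z hz
  have hcos : 0 < Real.cos α := Real.cos_pos_of_mem_Ioo ⟨hα₁, hα₂⟩
  have hcp : 0 < c := by rw [hc]; exact mul_pos (by linarith) hcos
  set e : ℂ := Complex.exp (Complex.I * (α : ℂ)) with he
  have hem : Complex.exp (-(Complex.I * (α : ℂ))) = e⁻¹ := Complex.exp_neg _
  have he0 : e ≠ 0 := Complex.exp_ne_zero _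
  have hen : ‖e‖ = 1 := by rw [he, mul_comm, Complex.norm_exp_ofReal_mul_I]
  have here : e.re = Real.cos α := by
    rw [he, mul_comm]
    exact Complex.exp_ofReal_mul_I_re α
  rw [hem]
  have hk : (1 - (β : ℂ)) * e⁻¹ * (Real.cos α : ℂ) = c * e⁻¹ := by
    rw [hc]; push_cast; ring
  rw [hk]
  set k : ℂ := c * e⁻¹ with hkdef
  have hcC : (c : ℂ) ≠ 0 := by exact_mod_cast hcp.ne'
  have hk0 : k ≠ 0 := mul_ne_zero hcC (inv_ne_zero he0)
  have hkn : ‖k‖ = c := by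
    rw [hkdef, norm_mul, norm_inv, hen, Complex.norm_real, Real.norm_of_nonneg hcp.le]; simp
  set P : ℂ → ℂ := fun w => deriv (deriv f) w / deriv f w with hP
  have hd1 : DifferentiableOn ℂ (deriv f) (Metric.ball 0 1) := hf.deriv Metric.isOpen_ball
  have hPd : DifferentiableOn ℂ P (Metric.ball 0 1) :=
    (hd1.deriv Metric.isOpen_ball).div hd1 hf'
  have hQ : ∀ w ∈ Metric.ball (0 : ℂ) 1, 0 < c + (e * (w * P w)).re := by
    intro w hw
    have h := hsp w hw
    have h1 : e * (1 + w * deriv (deriv f) w / deriv f w) = e + e * (w * P w) := by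
      simp only [hP]; ring
    rw [h1, Complex.add_re, here] at h
    rw [hc]; linarith
  have hlt : ∀ w ∈ Metric.ball (0 : ℂ) 1, ‖w * P w‖ < ‖2 * k + w * P w‖ := by
    intro w hw
    have h := hQ w hw
    have h1 : ‖w * P w‖ = ‖e * (w * P w)‖ := by rw [norm_mul e, hen, one_mul]
    have h2 : ‖2 * k + w * P w‖ = ‖2 * (c : ℂ) + e * (w * P w)‖ := by
      rw [← one_mul ‖2 * k + w * P w‖, ← hen, ← norm_mul]
      congr 1
      rw [hkdef]; field_simp
    rw [h1, h2]
    generalize e * (w * P w) = u at h ⊢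
    refine lt_of_pow_lt_pow_left₀ 2 (norm_nonneg _) ?_
    simp only [← Complex.normSq_eq_norm_sq, Complex.normSq_apply]
    simp
    nlinarith
  have hden : ∀ w ∈ Metric.ball (0 : ℂ) 1, 2 * k + w * P w ≠ 0 := fun w hw =>
    norm_pos_iff.mp (lt_of_le_of_lt (norm_nonneg _) (hlt w hw))
  set φ : ℂ → ℂ := fun w => P w / (2 * k + w * P w) with hφ
  have hφd : DifferentiableOn ℂ φ (Metric.ball 0 1) :=
    hPd.div ((differentiableOn_id.mul hPd).const_add _) hden
  have hφ0 : ‖φ 0‖ = ξ := by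
    rw [hξ]
    simp only [hφ, hP, hf1]
    simp [hkn]
  have hφle : ∀ w ∈ Metric.ball (0 : ℂ) 1, ‖φ w‖ ≤ 1 := by
    intro w hw
    by_cases hw0 : w = 0
    · rw [hw0, hφ0]; exact hξ1.le
    have hwp : 0 < ‖w‖ := norm_pos_iff.mpr hw0
    have hmaps : Set.MapsTo (fun w => w * φ w) (Metric.ball 0 1) (Metric.closedBall 0 1) := by
      intro v hv
      have hp : 0 < ‖2 * k + v * P v‖ := norm_pos_iff.mpr (hden v hv)
      have : ‖v * φ v‖ ≤ 1 := by
        rw [show v * φ v = (v * P v) / (2 * k + v * P v) by simp only [hφ]; ring, norm_div,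
          div_le_one hp]
        exact (hlt v hv).le
      simpa using this
    have := Complex.norm_le_norm_of_mapsTo_ball (differentiableOn_id.mul hφd) hmaps (by simp)
      (by simpa using hw : ‖w‖ < 1)
    simp only [Pi.mul_apply, norm_mul] at this
    exact le_of_mul_le_mul_left (by linarith) hwp
  have hφlt := aux_strict hφd hφle (by rw [hφ0]; exact hξ1)
  have hz1 : ‖z‖ < 1 := by simpa using hz
  have hgrow := aux_growth hφd hφlt hz1
  have hpick := aux_pick hφd hφlt hz1
  rw [hφ0] at hgrow
  have hφz := hφlt z hz
  have hne : ∀ w ∈ Metric.ball (0 : ℂ) 1, 1 - w * φ w ≠ 0 := by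
    intro w hw h
    have h1 : ‖w‖ * ‖φ w‖ = 1 := by
      rw [← norm_mul, show w * φ w = 1 by linear_combination -h, norm_one]
    have h2 : ‖w‖ < 1 := by simpa using hw
    nlinarith [hφlt w hw, norm_nonneg w, norm_nonneg (φ w)]
  have hPφ : ∀ w ∈ Metric.ball (0 : ℂ) 1, P w = 2 * k * φ w / (1 - w * φ w) := by
    intro w hw
    rw [eq_div_iff (hne w hw)]
    have h1 : φ w * (2 * k + w * P w) = P w := div_mul_cancel₀ _ (hden w hw)
    linear_combination -h1
  have hφh : HasDerivAt φ (deriv φ z) z :=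
    (hφd.differentiableAt (Metric.isOpen_ball.mem_nhds hz)).hasDerivAt
  have hPder : deriv P z = 2 * k * (deriv φ z + φ z ^ 2) / (1 - z * φ z) ^ 2 := by
    have hev : P =ᶠ[nhds z] fun w => 2 * k * φ w / (1 - w * φ w) :=
      Filter.eventually_of_mem (Metric.isOpen_ball.mem_nhds hz) hPφ
    rw [hev.deriv_eq]
    have := (hφh.const_mul (2 * k)).div (((hasDerivAt_id z).mul hφh).const_sub 1) (hne z hz)
    refine this.deriv.trans ?_
    simp
    congr 1
    ring
  have hS : deriv P z - (1 / 2 : ℂ) * (deriv (deriv f) z / deriv f z) ^ 2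
      = 2 * k * (deriv φ z + (1 - k) * φ z ^ 2) / (1 - z * φ z) ^ 2 := by
    rw [show deriv (deriv f) z / deriv f z = P z from rfl, hPder, hPφ z hz]
    have := hne z hz
    field_simp
    ring
  rw [hS, norm_div, norm_mul, norm_mul, norm_pow, hkn]
  have hD : 1 - ‖z‖ * ‖φ z‖ ≤ ‖1 - z * φ z‖ := by
    have := norm_sub_norm_le (1 : ℂ) (z * φ z)
    simpa using this
  have hfin := aux_real (norm_nonneg z) hz1 (norm_nonneg (φ z)) hφz
    (by rw [← hφ0]; exact norm_nonneg _) hξ1 (norm_nonneg (1 - k)) hgrow hpick hD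
  have htri : ‖deriv φ z + (1 - k) * φ z ^ 2‖ ≤ ‖deriv φ z‖ + ‖1 - k‖ * ‖φ z‖ ^ 2 := by
    refine (norm_add_le _ _).trans ?_
    rw [norm_mul, norm_pow]
  calc (1 - ‖z‖ ^ 2) ^ 2 * (‖(2 : ℂ)‖ * c * ‖deriv φ z + (1 - k) * φ z ^ 2‖ / ‖1 - z * φ z‖ ^ 2)
      ≤ (1 - ‖z‖ ^ 2) ^ 2 * (‖(2 : ℂ)‖ * c * (‖deriv φ z‖ + ‖1 - k‖ * ‖φ z‖ ^ 2)
          / ‖1 - z * φ z‖ ^ 2) := by gcongr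
    _ = 2 * c * ((1 - ‖z‖ ^ 2) ^ 2 * ((‖deriv φ z‖ + ‖1 - k‖ * ‖φ z‖ ^ 2)
          / ‖1 - z * φ z‖ ^ 2)) := by
        rw [Complex.norm_ofNat]; ring
    _ ≤ _ := mul_le_mul_of_nonneg_left hfin (by positivity)
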